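/- Let 𝒢 be a quasi-compact ample groupoid and V ⊆ 𝒢⁰ a compact open subset. Then W = r(s⁻¹(V)) is a compact open invariant subset of 𝒢⁰ containing V. In particular, if U ⊆ 𝒢⁰ is open and invariant, then every compact open subset of U is contained in a compact open invariant subset of U. -/

import Mathlib

universe u

/-- The algebraic operations of a groupoid (identified with its set of arrows):
a (partially meaningful) composition `gmul` and an inversion `ginv`.  The product
`gmul g h` is only required to behave like composition when `g` and `h` are
composable, i.e. when `src g = rng h`. -/
class GroupoidOps (G : Type u) where
  gmul : G → G → G
  ginv : G → G

namespace GroupoidOps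

variable {G : Type u} [GroupoidOps G]

/-- The source map `s g = g⁻¹ g`. -/
def src (g : G) : G := gmul (ginv g) g

/-- The range map `r g = g g⁻¹`. -/
def rng (g : G) : G := gmul g (ginv g)

/-- The unit space `𝒢⁰`: the set of identity arrows. -/
def unitSpace (G : Type u) [GroupoidOps G] : Set G := {x : G | src x = x}

end GroupoidOps

open GroupoidOps

/-- A topological groupoid: a groupoid `G`, identified with its arrow space, equipped
with a topology such that inversion is continuous and composition is continuous on the
set of composable pairs. -/
class TopologicalGroupoid (G : Type u) extends TopologicalSpace G, GroupoidOps G where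
  ginv_ginv : ∀ g : G, ginv (ginv g) = g
  gmul_src : ∀ g : G, gmul g (src g) = g
  rng_gmul : ∀ g : G, gmul (rng g) g = g
  gmul_assoc : ∀ g h k : G, src g = rng h → src h = rng k →
    gmul (gmul g h) k = gmul g (gmul h k)
  src_gmul : ∀ g h : G, src g = rng h → src (gmul g h) = src h
  rng_gmul_comp : ∀ g h : G, src g = rng h → rng (gmul g h) = rng g
  ginv_gmul : ∀ g h : G, src g = rng h → ginv (gmul g h) = gmul (ginv h) (ginv g)
  ginv_unit : ∀ x : G, src x = x → ginv x = x
  src_src : ∀ g : G, src (src g) = src g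
  src_rng : ∀ g : G, src (rng g) = rng g
  continuous_ginv : Continuous (ginv : G → G)
  continuous_gmul : Continuous fun p : {p : G × G // src p.1 = rng p.2} => gmul p.1.1 p.1.2

/-- An ample groupoid: a topological groupoid (not necessarily Hausdorff) whose unit
space is locally compact, Hausdorff and totally disconnected in the subspace topology,
and whose source map, viewed as a map `G → 𝒢⁰`, is a local homeomorphism. -/
class AmpleGroupoid (G : Type u) extends TopologicalGroupoid G where
  t2_unitSpace : T2Space (unitSpace G)
  locallyCompact_unitSpace : LocallyCompactSpace (unitSpace G)
  totallyDisconnected_unitSpace : TotallyDisconnectedSpace (unitSpace G)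
  isLocalHomeomorph_src :
    IsLocalHomeomorph fun g : G => (⟨src g, TopologicalGroupoid.src_src g⟩ : unitSpace G)

namespace TopologicalGroupoid

variable {G : Type u} [TopologicalGroupoid G]

/-- A bisection: an open subset on which both the source and the range map are injective. -/
def IsBisection (U : Set G) : Prop :=
  IsOpen U ∧ Set.InjOn (src : G → G) U ∧ Set.InjOn (rng : G → G) U

/-- A compact bisection: a bisection which is compact
(quasi-compact and Hausdorff in the subspace topology). -/
def IsCompactBisection (U : Set G) : Prop :=
  IsBisection U ∧ IsCompact U ∧ T2Space U

/-- Setwise inverse `U⁻¹ = { u⁻¹ : u ∈ U }`. -/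
def setInv (U : Set G) : Set G := ginv '' U

/-- Setwise product `UV = { uv : u ∈ U, v ∈ V, s(u) = r(v) }`. -/
def setMul (U V : Set G) : Set G :=
  {x : G | ∃ u ∈ U, ∃ v ∈ V, src u = rng v ∧ x = gmul u v}

/-- A subgroupoid: a subset closed under inversion and (composable) composition. -/
def IsSubgroupoid (H : Set G) : Prop :=
  (∀ g ∈ H, ginv g ∈ H) ∧ ∀ g ∈ H, ∀ h ∈ H, src g = rng h → gmul g h ∈ H

/-- A groupoid is principal if every isotropy element is a unit. -/
def IsPrincipal (G : Type u) [TopologicalGroupoid G] : Prop :=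
  ∀ g : G, src g = rng g → g ∈ unitSpace G

/-- The orbit of `x`, namely `r(s⁻¹(x))`. -/
def orbit (x : G) : Set G := {y : G | ∃ g : G, src g = x ∧ rng g = y}

/-- A subset of the unit space is invariant if it is a union of orbits. -/
def IsInvariant (U : Set G) : Prop := ∀ g : G, src g ∈ U → rng g ∈ U

/-- An inverse semigroup of compact bisections: a nonempty collection of compact
bisections closed under setwise product and setwise inverse. -/
def IsInvSemigroupOfCompactBisections (S : Set (Set G)) : Prop :=
  S.Nonempty ∧ (∀ U ∈ S, IsCompactBisection U) ∧
    (∀ U ∈ S, setInv U ∈ S) ∧ ∀ U ∈ S, ∀ V ∈ S, setMul U V ∈ S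

/-- The orbit equivalence relation `𝓡` on the unit space. -/
def orbitRel (G : Type u) [TopologicalGroupoid G] :
    unitSpace G → unitSpace G → Prop :=
  fun x y => ∃ g : G, src g = (x : G) ∧ rng g = (y : G)

end TopologicalGroupoid

open TopologicalGroupoid

namespace TopologicalGroupoid

variable {G : Type u} [TopologicalGroupoid G]

theorem src_ginv (g : G) : src (ginv g) = rng g := by
  simp only [src, rng, ginv_ginv]

theorem rng_eq_src_of_mem_unitSpace {x : G} (hx : x ∈ unitSpace G) : rng x = src x := by
  simp only [src, rng, ginv_unit x hx]

/-- The source map with values in the unit space. -/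
def srcUnit (g : G) : unitSpace G := ⟨src g, src_src g⟩

/-- The range map with values in the unit space. -/
def rngUnit (g : G) : unitSpace G := ⟨rng g, src_rng g⟩

theorem rngUnit_eq_comp : (rngUnit : G → unitSpace G) = srcUnit ∘ ginv :=
  funext fun g => Subtype.ext (src_ginv g).symm

theorem isOpenMap_ginv : IsOpenMap (ginv : G → G) :=
  (Homeomorph.mk ⟨ginv, ginv, ginv_ginv, ginv_ginv⟩ continuous_ginv continuous_ginv).isOpenMap

theorem image_rng_eq (V : Set G) :
    rng '' {g : G | src g ∈ V} =
      Subtype.val '' (rngUnit '' (srcUnit ⁻¹' (Subtype.val ⁻¹' V : Set (unitSpace G)))) := by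
  rw [Set.image_image]
  rfl

theorem subset_image_rng {V : Set G} (hV : V ⊆ unitSpace G) :
    V ⊆ rng '' {g : G | src g ∈ V} := fun x hx =>
  have hs : src x = x := hV hx
  ⟨x, show src x ∈ V by rwa [hs], (rng_eq_src_of_mem_unitSpace (hV hx)).trans hs⟩

theorem isInvariant_image_rng (V : Set G) : IsInvariant (rng '' {g : G | src g ∈ V}) := by
  rintro g ⟨h, hh, hgh⟩
  refine ⟨gmul g h, ?_, rng_gmul_comp g h hgh.symm⟩
  change src (gmul g h) ∈ V
  rwa [src_gmul g h hgh.symm]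

end TopologicalGroupoid

namespace AmpleGroupoid

variable {G : Type u} [AmpleGroupoid G]

theorem continuous_rngUnit : Continuous (rngUnit : G → unitSpace G) :=
  rngUnit_eq_comp (G := G) ▸ (isLocalHomeomorph_src (G := G)).continuous.comp continuous_ginv

theorem isOpenMap_rngUnit : IsOpenMap (rngUnit : G → unitSpace G) :=
  rngUnit_eq_comp (G := G) ▸ (isLocalHomeomorph_src (G := G)).isOpenMap.comp isOpenMap_ginv

theorem isOpen_image_rng {V : Set G} (hV : IsOpen (Subtype.val ⁻¹' V : Set (unitSpace G))) :
    IsOpen (Subtype.val ⁻¹' (rng '' {g : G | src g ∈ V}) : Set (unitSpace G)) := by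
  rw [image_rng_eq, Set.preimage_image_eq _ Subtype.val_injective]
  exact isOpenMap_rngUnit _ (hV.preimage (isLocalHomeomorph_src (G := G)).continuous)

theorem isCompact_image_rng [CompactSpace G] {V : Set G} (hV : V ⊆ unitSpace G)
    (hc : IsCompact V) : IsCompact (rng '' {g : G | src g ∈ V}) := by
  have := t2_unitSpace (G := G)
  have hV' : IsCompact (Subtype.val ⁻¹' V : Set (unitSpace G)) := by
    rw [Subtype.isCompact_iff, Subtype.image_preimage_coe, Set.inter_eq_right.2 hV]
    exact hc
  rw [image_rng_eq]
  have hA := (hV'.isClosed.preimage (isLocalHomeomorph_src (G := G)).continuous).isCompact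
  exact (hA.image continuous_rngUnit).image continuous_subtype_val

end AmpleGroupoid

/-- Let `𝒢` be a quasi-compact ample groupoid and `V ⊆ 𝒢⁰` compact
open.  Then `W = r(s⁻¹(V))` is a compact open invariant subset of `𝒢⁰` containing `V`.
In particular, every compact open subset of an open invariant `U ⊆ 𝒢⁰` is contained in
a compact open invariant subset of `U`. -/
theorem saturation_compact_open_invariant (G : Type u) [AmpleGroupoid G]
    [CompactSpace G] :
    (∀ V : Set G, V ⊆ unitSpace G → IsCompact V →
      IsOpen (Subtype.val ⁻¹' V : Set (unitSpace G)) →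
      V ⊆ rng '' {g : G | src g ∈ V} ∧
      rng '' {g : G | src g ∈ V} ⊆ unitSpace G ∧
      IsCompact (rng '' {g : G | src g ∈ V}) ∧
      IsOpen (Subtype.val ⁻¹' (rng '' {g : G | src g ∈ V}) : Set (unitSpace G)) ∧
      IsInvariant (rng '' {g : G | src g ∈ V})) ∧
    (∀ U : Set G, U ⊆ unitSpace G → IsOpen (Subtype.val ⁻¹' U : Set (unitSpace G)) →
      IsInvariant U → ∀ V : Set G, V ⊆ U → IsCompact V →
      IsOpen (Subtype.val ⁻¹' V : Set (unitSpace G)) →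
      ∃ W : Set G, V ⊆ W ∧ W ⊆ U ∧ IsCompact W ∧
        IsOpen (Subtype.val ⁻¹' W : Set (unitSpace G)) ∧ IsInvariant W) := by
  have saturation {V : Set G} (hV : V ⊆ unitSpace G) (hc : IsCompact V)
      (ho : IsOpen (Subtype.val ⁻¹' V : Set (unitSpace G))) :=
    And.intro (AmpleGroupoid.isCompact_image_rng hV hc)
      (And.intro (AmpleGroupoid.isOpen_image_rng ho) (isInvariant_image_rng V))
  refine ⟨fun V hV hc ho => ⟨subset_image_rng hV, ?_, saturation hV hc ho⟩,
    fun U hU _ hinv V hVU hc ho =>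
      ⟨_, subset_image_rng (hVU.trans hU), ?_, saturation (hVU.trans hU) hc ho⟩⟩
  · rintro _ ⟨g, -, rfl⟩
    exact src_rng g
  · rintro _ ⟨g, hg, rfl⟩
    exact hinv g (hVU hg)
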